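/- For every t ∈ [0,T), F₀''(t) ≥ K₁ (t+R)^{−n(p−1)} |F₀(t)|^p, where K₁ = 1/(vol 𝐁ⁿ)^{p−1} and vol 𝐁ⁿ is the volume of the unit ball in ℝⁿ. -/

import Mathlib

open MeasureTheory Metric Set ENNReal Filter

noncomputable section

/-- The Laplacian of `f : ℝⁿ → ℝ`, as the sum of the second derivatives along the
coordinate directions. -/
def lap (n : ℕ) (f : EuclideanSpace ℝ (Fin n) → ℝ) (x : EuclideanSpace ℝ (Fin n)) : ℝ :=
  ∑ i : Fin n, iteratedDeriv 2 (fun s : ℝ => f (x + s • EuclideanSpace.single i (1 : ℝ))) 0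

/-- The time interval `[0, T)`, where `T : ℝ≥0∞` may be infinite. -/
def timeSet (T : ℝ≥0∞) : Set ℝ := {t : ℝ | 0 ≤ t ∧ ENNReal.ofReal t < T}

open scoped Topology

lemma mem_timeSet_Iio {T : ℝ≥0∞} {t : ℝ} (ht : t ∈ timeSet T) :
    {s : ℝ | ENNReal.ofReal s < T} ∈ 𝓝 t :=
  (isOpen_Iio.preimage ENNReal.continuous_ofReal).mem_nhds ht.2

lemma nhdsWithin_timeSet {T : ℝ≥0∞} {t : ℝ} (ht : t ∈ timeSet T) :
    𝓝[timeSet T] t = 𝓝[Ici 0] t :=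
  nhdsWithin_inter_of_mem' (s := Ici (0 : ℝ)) (t := {s : ℝ | ENNReal.ofReal s < T})
    (mem_nhdsWithin_of_mem_nhds (mem_timeSet_Iio ht))

lemma timeSet_mem_nhds {T : ℝ≥0∞} {t : ℝ} (ht : t ∈ timeSet T) (h0 : 0 < t) :
    timeSet T ∈ 𝓝 t := by
  filter_upwards [mem_timeSet_Iio ht, Ioi_mem_nhds h0] with s hs hs0 using ⟨le_of_lt hs0, hs⟩

lemma uniqueDiffOn_timeSet (T : ℝ≥0∞) : UniqueDiffOn ℝ (timeSet T) := fun t ht =>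
  (uniqueDiffOn_Ici (0 : ℝ) t ht.1).mono_nhds (nhdsWithin_timeSet ht).ge

lemma derivWithin_eq_zero_of_supp {E : Type*} [NormedAddCommGroup E] {f : E → ℝ → ℝ} {S : Set ℝ} {R : ℝ}
    (hf : ∀ x, ∀ t ∈ S, t + R < ‖x‖ → f x t = 0) (x : E) (t : ℝ) (ht : t ∈ S)
    (hx : t + R < ‖x‖) : derivWithin (f x) S t = 0 := by
  have h : f x =ᶠ[𝓝[S] t] fun _ => 0 := by
    have : Iio (‖x‖ - R) ∈ 𝓝 t := Iio_mem_nhds (by linarith)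
    filter_upwards [self_mem_nhdsWithin, mem_nhdsWithin_of_mem_nhds this] with s hs hs'
    exact hf x s hs (by have := mem_Iio.1 hs'; linarith)
  rw [h.derivWithin_eq (hf x t ht hx)]
  simp

lemma continuous_slice {E : Type*} [TopologicalSpace E] {f : E → ℝ → ℝ} {S : Set ℝ}
    (hc : ContinuousOn (fun q : E × ℝ => f q.1 q.2) (univ ×ˢ S)) {t : ℝ} (ht : t ∈ S) :
    Continuous (fun x => f x t) := by
  rw [← continuousOn_univ]
  exact hc.comp (f := fun x : E => (x, t)) (by fun_prop) (fun x _ => ⟨mem_univ _, ht⟩)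

lemma hasCompactSupport_of_norm_gt {E : Type*} [NormedAddCommGroup E] [ProperSpace E]
    {f : E → ℝ} {r : ℝ} (hf : ∀ x, r < ‖x‖ → f x = 0) :
    HasCompactSupport f :=
  HasCompactSupport.intro (isCompact_closedBall (0 : E) r) fun x hx => hf x (by simpa using hx)

section Spacetime

variable {E : Type*} [NormedAddCommGroup E] [NormedSpace ℝ E]

lemma hasDerivWithinAt_slice {f : E → ℝ → ℝ} {S : Set ℝ}
    (hf : ContDiffOn ℝ 1 (fun q : E × ℝ => f q.1 q.2) (univ ×ˢ S)) (x : E) {t : ℝ} (ht : t ∈ S) :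
    HasDerivWithinAt (f x)
      (fderivWithin ℝ (fun q : E × ℝ => f q.1 q.2) (univ ×ˢ S) (x, t) (0, 1)) S t := by
  have h := (hf.differentiableOn one_ne_zero (x, t) ⟨mem_univ _, ht⟩).hasFDerivWithinAt
  exact h.comp_hasDerivWithinAt t (f := fun s => (x, s))
    ((hasDerivWithinAt_const t S x).prodMk (hasDerivWithinAt_id t S))
    (fun s hs => ⟨mem_univ _, hs⟩)

lemma contDiffOn_derivWithin_slice {f : E → ℝ → ℝ} {S : Set ℝ} {m k : WithTop ℕ∞}
    (hS : UniqueDiffOn ℝ S) (hmk : m + 1 ≤ k)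
    (hf : ContDiffOn ℝ k (fun q : E × ℝ => f q.1 q.2) (univ ×ˢ S)) :
    ContDiffOn ℝ m (fun q : E × ℝ => derivWithin (f q.1) S q.2) (univ ×ˢ S) := by
  have hU : UniqueDiffOn ℝ ((univ : Set E) ×ˢ S) := uniqueDiffOn_univ.prod hS
  refine ((hf.fderivWithin hU hmk).clm_apply (contDiffOn_const (c := ((0 : E), (1 : ℝ))))).congr ?_
  rintro ⟨x, t⟩ ⟨-, ht⟩
  exact (hasDerivWithinAt_slice (hf.of_le (le_trans le_add_self hmk)) x ht).derivWithin (hS t ht)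

variable [FiniteDimensional ℝ E] [MeasurableSpace E] [BorelSpace E] {μ : Measure E}

lemma continuousOn_integral_of_supp [IsFiniteMeasureOnCompacts μ] {f : E → ℝ → ℝ} {S : Set ℝ}
    {R : ℝ} (hc : ContinuousOn (fun q : E × ℝ => f q.1 q.2) (univ ×ˢ S))
    (hf : ∀ x, ∀ t ∈ S, t + R < ‖x‖ → f x t = 0) :
    ContinuousOn (fun t => ∫ x, f x t ∂μ) S := by
  intro t ht
  have : ContinuousOn (fun t => ∫ x, f x t ∂μ) (S ∩ Iio (t + 1)) := by
    refine continuousOn_integral_of_compact_support (f := fun t x => f x t)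
      (isCompact_closedBall (0 : E) (t + 1 + R)) ?_ ?_
    · exact hc.comp (f := fun q : ℝ × E => (q.2, q.1)) continuous_swap.continuousOn
        (fun q hq => ⟨mem_univ _, hq.1.1⟩)
    · intro s x hs hx
      have h2 := mem_Iio.1 hs.2
      simp only [mem_closedBall, dist_zero_right, not_le] at hx
      exact hf x s hs.1 (by linarith)
  exact (continuousWithinAt_inter (Iio_mem_nhds (by linarith))).1
    (this t ⟨ht, by simp⟩)

lemma hasDerivAt_integral_of_supp [IsFiniteMeasureOnCompacts μ] {f g : E → ℝ → ℝ} {S : Set ℝ}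
    {R : ℝ} (hfc : ContinuousOn (fun q : E × ℝ => f q.1 q.2) (univ ×ˢ S))
    (hgc : ContinuousOn (fun q : E × ℝ => g q.1 q.2) (univ ×ˢ S))
    (hf : ∀ x, ∀ t ∈ S, t + R < ‖x‖ → f x t = 0) (hg : ∀ x, ∀ t ∈ S, t + R < ‖x‖ → g x t = 0)
    (hd : ∀ x, ∀ t ∈ S, HasDerivWithinAt (f x) (g x t) S t) {t : ℝ} (ht : S ∈ 𝓝 t) :
    HasDerivAt (fun t => ∫ x, f x t ∂μ) (∫ x, g x t ∂μ) t := by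
  have htS := mem_of_mem_nhds ht
  obtain ⟨ε, hε, hεS⟩ := Metric.nhds_basis_closedBall.mem_iff.1 (interior_mem_nhds.2 ht)
  have hεS' := hεS.trans interior_subset
  set K := closedBall (0 : E) (t + ε + R)
  have hK : IsCompact K := isCompact_closedBall _ _
  obtain ⟨C, hC⟩ := (hK.prod (isCompact_closedBall t ε)).exists_bound_of_continuousOn
    (hgc.mono (prod_mono (subset_univ _) hεS'))
  refine (hasDerivAt_integral_of_dominated_loc_of_deriv_le (F := fun t x => f x t)
    (F' := fun t x => g x t) (bound := K.indicator fun _ => C)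
    (closedBall_mem_nhds t hε) ?_ ?_ ?_ ?_ ?_ ?_).2
  · filter_upwards [ht] with s hs using (continuous_slice hfc hs).aestronglyMeasurable
  · exact (continuous_slice hfc htS).integrable_of_hasCompactSupport
      (hasCompactSupport_of_norm_gt fun x hx => hf x t htS hx)
  · exact (continuous_slice hgc htS).aestronglyMeasurable
  · refine ae_of_all _ fun x s hs => ?_
    by_cases hx : x ∈ K
    · rw [indicator_of_mem hx]
      exact hC (x, s) ⟨hx, hs⟩
    · rw [indicator_of_notMem hx, hg x s (hεS' hs), norm_zero]
      rw [mem_closedBall, Real.dist_eq] at hs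
      simp only [K, mem_closedBall, dist_zero_right, not_le] at hx
      linarith [le_abs_self (s - t)]
  · exact (integrable_indicator_iff hK.measurableSet).2
      (integrableOn_const hK.measure_ne_top)
  · exact ae_of_all _ fun x s hs =>
      (hd x s (hεS' hs)).hasDerivAt (mem_interior_iff_mem_nhds.1 (hεS hs))

lemma hasDerivWithinAt_integral_timeSet [IsFiniteMeasureOnCompacts μ] {f g : E → ℝ → ℝ}
    {T : ℝ≥0∞} {R : ℝ} (hfc : ContinuousOn (fun q : E × ℝ => f q.1 q.2) (univ ×ˢ timeSet T))
    (hgc : ContinuousOn (fun q : E × ℝ => g q.1 q.2) (univ ×ˢ timeSet T))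
    (hf : ∀ x, ∀ t ∈ timeSet T, t + R < ‖x‖ → f x t = 0)
    (hg : ∀ x, ∀ t ∈ timeSet T, t + R < ‖x‖ → g x t = 0)
    (hd : ∀ x, ∀ t ∈ timeSet T, HasDerivWithinAt (f x) (g x t) (timeSet T) t)
    {t : ℝ} (ht : t ∈ timeSet T) :
    HasDerivWithinAt (fun t => ∫ x, f x t ∂μ) (∫ x, g x t ∂μ) (timeSet T) t := by
  have key : ∀ s ∈ timeSet T, 0 < s →
      HasDerivAt (fun t => ∫ x, f x t ∂μ) (∫ x, g x s ∂μ) s := fun s hs hs0 =>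
    hasDerivAt_integral_of_supp hfc hgc hf hg hd (timeSet_mem_nhds hs hs0)
  rcases ht.1.eq_or_lt with rfl | h0
  · have hpos : timeSet T ∩ Ioi 0 ∈ 𝓝[>] (0 : ℝ) := by
      refine inter_mem ?_ self_mem_nhdsWithin
      filter_upwards [mem_nhdsWithin_of_mem_nhds (mem_timeSet_Iio ht), self_mem_nhdsWithin]
        with s hs hs0 using ⟨le_of_lt hs0, hs⟩
    refine (hasDerivWithinAt_Ici_of_tendsto_deriv (s := timeSet T ∩ Ioi 0)
      (fun s hs => (key s hs.1 hs.2).differentiableAt.differentiableWithinAt)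
      ((continuousOn_integral_of_supp hfc hf 0 ht).mono inter_subset_left) hpos ?_).mono
      (fun s hs => hs.1)
    have hlim := (continuousOn_integral_of_supp (μ := μ) hgc hg 0 ht).tendsto
    rw [nhdsWithin_timeSet ht] at hlim
    refine (hlim.mono_left (nhdsWithin_mono _ Ioi_subset_Ici_self)).congr' ?_
    filter_upwards [hpos] with s hs using (key s hs.1 hs.2).deriv.symm
  · exact (key t ht h0).hasDerivWithinAt

lemma integral_fderiv_apply_eq_zero [μ.IsAddHaarMeasure] {f : E → ℝ} (hf : ContDiff ℝ 1 f)
    (hs : HasCompactSupport f) (v : E) : ∫ x, fderiv ℝ f x v ∂μ = 0 := by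
  have hc : Continuous fun x => fderiv ℝ f x v :=
    (hf.continuous_fderiv one_ne_zero).clm_apply continuous_const
  have h := integral_mul_fderiv_eq_neg_fderiv_mul_of_integrable (μ := μ) (f := fun _ : E => (1 : ℝ))
    (g := f) (v := v) (by simp)
    (by simpa using hc.integrable_of_hasCompactSupport (hs.fderiv_apply (𝕜 := ℝ) v))
    (by simpa using hf.continuous.integrable_of_hasCompactSupport hs)
    (fun x _ => by fun_prop) (fun x _ => hf.differentiable one_ne_zero x)
  simpa using h

end Spacetime

lemma lap_eq_sum_fderiv {n : ℕ} {f : EuclideanSpace ℝ (Fin n) → ℝ} (hf : ContDiff ℝ 2 f)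
    (x : EuclideanSpace ℝ (Fin n)) :
    lap n f x = ∑ i : Fin n, fderiv ℝ (fun y => fderiv ℝ f y (EuclideanSpace.single i 1)) x
      (EuclideanSpace.single i 1) := by
  refine Finset.sum_congr rfl fun i _ => ?_
  set e : EuclideanSpace ℝ (Fin n) := EuclideanSpace.single i 1
  have hline : ∀ s : ℝ, HasDerivAt (fun s : ℝ => x + s • e) e s := fun s => by
    simpa using ((hasDerivAt_id s).smul_const e).const_add x
  have h1 : deriv (fun s : ℝ => f (x + s • e)) = fun s => fderiv ℝ f (x + s • e) e := by
    funext s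
    exact ((hf.differentiable two_ne_zero _).hasFDerivAt.comp_hasDerivAt s (hline s)).deriv
  have hd : Differentiable ℝ fun y => fderiv ℝ f y e :=
    ((hf.fderiv_right (m := 1) (by norm_num)).clm_apply contDiff_const).differentiable one_ne_zero
  rw [iteratedDeriv_succ, iteratedDeriv_one, h1]
  have := ((hd (x + (0 : ℝ) • e)).hasFDerivAt.comp_hasDerivAt 0 (hline 0)).deriv
  simpa [Function.comp_def] using this

lemma continuous_lap {n : ℕ} {f : EuclideanSpace ℝ (Fin n) → ℝ} (hf : ContDiff ℝ 2 f) :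
    Continuous (lap n f) := by
  rw [funext (lap_eq_sum_fderiv hf)]
  refine continuous_finsetSum _ fun i _ => ?_
  exact (((hf.fderiv_right (m := 1) (by norm_num)).clm_apply
    contDiff_const).continuous_fderiv one_ne_zero).clm_apply continuous_const

lemma integral_lap_eq_zero {n : ℕ} {f : EuclideanSpace ℝ (Fin n) → ℝ} (hf : ContDiff ℝ 2 f)
    (hs : HasCompactSupport f) : ∫ x, lap n f x = 0 := by
  have hd (v) : ContDiff ℝ 1 fun y => fderiv ℝ f y v :=
    (hf.fderiv_right (m := 1) (by norm_num)).clm_apply contDiff_const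
  simp_rw [lap_eq_sum_fderiv hf]
  rw [integral_finsetSum]
  · exact Finset.sum_eq_zero fun i _ =>
      integral_fderiv_apply_eq_zero (hd _) (hs.fderiv_apply (𝕜 := ℝ) _) _
  · intro i _
    exact (((hd _).continuous_fderiv one_ne_zero).clm_apply
      continuous_const).integrable_of_hasCompactSupport
        ((hs.fderiv_apply (𝕜 := ℝ) _).fderiv_apply (𝕜 := ℝ) _)

lemma rpow_abs_integral_le {n : ℕ} {p r : ℝ} (hp : 1 < p) (hr : 0 < r)
    {f : EuclideanSpace ℝ (Fin n) → ℝ} (hf : Continuous f) (hs : ∀ x, r < ‖x‖ → f x = 0) :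
    (1 / (volume (Metric.ball (0 : EuclideanSpace ℝ (Fin n)) 1)).toReal ^ (p - 1)) *
      r ^ (-((n : ℝ) * (p - 1))) * |∫ x, f x| ^ p ≤ ∫ x, |f x| ^ p := by
  have hp0 : 0 < p := by linarith
  set ω := (volume (Metric.ball (0 : EuclideanSpace ℝ (Fin n)) 1)).toReal with hω
  set K := closedBall (0 : EuclideanSpace ℝ (Fin n)) r
  have hK : IsCompact K := isCompact_closedBall _ _
  have hωpos : 0 < ω := ENNReal.toReal_pos (measure_ball_pos _ _ one_pos).ne' measure_ball_lt_top.ne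
  have hV : volume.real K = r ^ n * ω := by
    simpa [measureReal_def] using
      Measure.addHaar_real_closedBall volume (0 : EuclideanSpace ℝ (Fin n)) hr.le
  have hVpos : 0 < r ^ n * ω := by positivity
  have hout : ∀ x, x ∉ K → f x = 0 := fun x hx => hs x (by simpa [K] using hx)
  have hfp : Continuous fun x => |f x| ^ p := hf.abs.rpow_const fun _ => Or.inr hp0.le
  have hI : ∫ x in K, |f x| = ∫ x, |f x| :=
    setIntegral_eq_integral_of_forall_compl_eq_zero fun x hx => by simp [hout x hx]
  have hJ : ∫ x in K, |f x| ^ p = ∫ x, |f x| ^ p :=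
    setIntegral_eq_integral_of_forall_compl_eq_zero fun x hx => by
      simp [hout x hx, Real.zero_rpow hp0.ne']
  have hjensen := (convexOn_rpow hp.le).map_set_average_le (μ := volume) (t := K)
    (f := fun x => |f x|) (Real.continuous_rpow_const hp0.le).continuousOn isClosed_Ici
    (measure_closedBall_pos _ _ hr).ne' hK.measure_ne_top
    (ae_of_all _ fun x => mem_Ici.2 (abs_nonneg (f x))) (hf.abs.continuousOn.integrableOn_compact hK)
    (hfp.continuousOn.integrableOn_compact hK)
  rw [setAverage_eq, setAverage_eq, hI, hJ, hV, smul_eq_mul, smul_eq_mul] at hjensen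
  set V := r ^ n * ω with hVdef
  have hcoef : 1 / ω ^ (p - 1) * r ^ (-((n : ℝ) * (p - 1))) = V * V⁻¹ ^ p := by
    have h1 : V * V⁻¹ ^ p = V ^ (-(p - 1)) := by
      rw [Real.inv_rpow hVpos.le, ← Real.rpow_neg hVpos.le]
      nth_rw 1 [← Real.rpow_one V]
      rw [← Real.rpow_add hVpos]
      ring_nf
    rw [h1, hVdef, Real.mul_rpow (by positivity) hωpos.le, ← Real.rpow_natCast,
      ← Real.rpow_mul hr.le, Real.rpow_neg hωpos.le, one_div, mul_comm]
    ring_nf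
  have hnn : 0 ≤ ∫ x, |f x| := integral_nonneg fun x => abs_nonneg _
  calc _ = V * V⁻¹ ^ p * |∫ x, f x| ^ p := by rw [hcoef]
    _ ≤ V * V⁻¹ ^ p * (∫ x, |f x|) ^ p := by
      gcongr
      exact abs_integral_le_integral_abs
    _ = V * (V⁻¹ * ∫ x, |f x|) ^ p := by
      rw [Real.mul_rpow (by positivity) hnn, mul_assoc]
    _ ≤ V * (V⁻¹ * ∫ x, |f x| ^ p) := by gcongr
    _ = _ := by field_simp

/-- **(2.3):** for every `t ∈ [0,T)`,
`F₀''(t) ≥ K₁ (t+R)^{-n(p-1)} |F₀(t)|^p` where `F₀(t) = ∫ u(x,t) dx` and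
`K₁ = 1 / (vol 𝐁ⁿ)^{p-1}`, `vol 𝐁ⁿ` being the volume of the unit ball of `ℝⁿ`. -/
theorem F0_differential_inequality
    (n : ℕ) (hn : 2 ≤ n) (p R : ℝ) (T : ℝ≥0∞)
    (hp : 1 < p) (hR : 0 < R) (hT : 0 < T)
    (u : EuclideanSpace ℝ (Fin n) → ℝ → ℝ) (u₀ u₁ : EuclideanSpace ℝ (Fin n) → ℝ)
    (hdata_supp : ∀ x : EuclideanSpace ℝ (Fin n), R < ‖x‖ → u₀ x = 0 ∧ u₁ x = 0)
    (hreg : ContDiffOn ℝ 2 (fun q : EuclideanSpace ℝ (Fin n) × ℝ => u q.1 q.2)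
      (Set.univ ×ˢ timeSet T))
    (heq : ∀ x, ∀ t ∈ timeSet T,
      lap n (fun y => u y t) x - iteratedDeriv 2 (u x) t + |u x t| ^ p = 0)
    (hinit₀ : ∀ x, u x 0 = u₀ x)
    (hinit₁ : ∀ x, deriv (u x) 0 = u₁ x)
    (hsupp : ∀ x, ∀ t ∈ timeSet T, t + R < ‖x‖ → u x t = 0 ∧ deriv (u x) t = 0) :
    ∀ t ∈ timeSet T,
      (1 / (volume (Metric.ball (0 : EuclideanSpace ℝ (Fin n)) 1)).toReal ^ (p - 1)) *
          (t + R) ^ (-((n : ℝ) * (p - 1))) * |∫ x, u x t| ^ p ≤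
        derivWithin (derivWithin (fun s : ℝ => ∫ x, u x s) (timeSet T)) (timeSet T) t := by
  have hS := uniqueDiffOn_timeSet T
  set S := timeSet T with hSdef
  set v : EuclideanSpace ℝ (Fin n) → ℝ → ℝ := fun x => derivWithin (u x) S with hv
  set w : EuclideanSpace ℝ (Fin n) → ℝ → ℝ := fun x => derivWithin (v x) S with hw
  have hvreg : ContDiffOn ℝ 1 (fun q : EuclideanSpace ℝ (Fin n) × ℝ => v q.1 q.2) (univ ×ˢ S) :=
    contDiffOn_derivWithin_slice hS (by norm_num) hreg
  have hwreg : ContDiffOn ℝ 0 (fun q : EuclideanSpace ℝ (Fin n) × ℝ => w q.1 q.2) (univ ×ˢ S) :=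
    contDiffOn_derivWithin_slice hS (by norm_num) hvreg
  have husupp : ∀ x, ∀ t ∈ S, t + R < ‖x‖ → u x t = 0 := fun x t ht hx => (hsupp x t ht hx).1
  have hvsupp : ∀ x, ∀ t ∈ S, t + R < ‖x‖ → v x t = 0 := derivWithin_eq_zero_of_supp husupp
  have hwsupp : ∀ x, ∀ t ∈ S, t + R < ‖x‖ → w x t = 0 := derivWithin_eq_zero_of_supp hvsupp
  have hud : ∀ x, ∀ t ∈ S, HasDerivWithinAt (u x) (v x t) S t := fun x t ht =>
    (hasDerivWithinAt_slice (hreg.of_le one_le_two) x ht).differentiableWithinAt.hasDerivWithinAt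
  have hvd : ∀ x, ∀ t ∈ S, HasDerivWithinAt (v x) (w x t) S t := fun x t ht =>
    (hasDerivWithinAt_slice hvreg x ht).differentiableWithinAt.hasDerivWithinAt
  have hF : ∀ t ∈ S, derivWithin (fun s : ℝ => ∫ x, u x s) S t = ∫ x, v x t := fun t ht =>
    (hasDerivWithinAt_integral_timeSet hreg.continuousOn hvreg.continuousOn husupp hvsupp hud
      ht).derivWithin (hS t ht)
  have hF2 : ∀ t ∈ S, derivWithin (derivWithin (fun s : ℝ => ∫ x, u x s) S) S t = ∫ x, w x t := by
    intro t ht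
    rw [derivWithin_congr hF (hF t ht)]
    exact (hasDerivWithinAt_integral_timeSet hvreg.continuousOn hwreg.continuousOn hvsupp hwsupp hvd
      ht).derivWithin (hS t ht)
  have hpos : ∀ t ∈ S ∩ Ioi 0,
      (1 / (volume (Metric.ball (0 : EuclideanSpace ℝ (Fin n)) 1)).toReal ^ (p - 1)) *
          (t + R) ^ (-((n : ℝ) * (p - 1))) * |∫ x, u x t| ^ p ≤ ∫ x, w x t := by
    rintro t ⟨ht, ht0⟩
    have hp0 : 0 < p := by linarith
    have hslice : ContDiff ℝ 2 fun x => u x t := by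
      rw [← contDiffOn_univ]
      exact hreg.comp (f := fun x => (x, t)) (by fun_prop) fun x _ => ⟨mem_univ _, ht⟩
    have hcs : HasCompactSupport fun x => u x t :=
      hasCompactSupport_of_norm_gt fun x hx => husupp x t ht hx
    have hnhds : S ∈ 𝓝 t := timeSet_mem_nhds ht ht0
    have hwt : ∀ x, w x t = lap n (fun y => u y t) x + |u x t| ^ p := by
      intro x
      have hderiv : deriv (u x) =ᶠ[𝓝 t] v x := by
        filter_upwards [eventually_mem_nhds_iff.2 hnhds] with s hs
        exact ((hud x s (mem_of_mem_nhds hs)).hasDerivAt hs).deriv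
      have h2 : iteratedDeriv 2 (u x) t = w x t := by
        rw [iteratedDeriv_succ, iteratedDeriv_one, hderiv.deriv_eq]
        exact ((hvd x t ht).hasDerivAt hnhds).deriv
      have := heq x t ht
      linarith
    have hpc : Continuous fun x => |u x t| ^ p :=
      hslice.continuous.abs.rpow_const fun _ => Or.inr hp0.le
    have hpcs : HasCompactSupport fun x => |u x t| ^ p :=
      hcs.comp_left (g := fun y : ℝ => |y| ^ p) (by simp [hp0.ne'])
    have hpi : Integrable fun x => |u x t| ^ p := hpc.integrable_of_hasCompactSupport hpcs
    have hlapi : Integrable (lap n fun y => u y t) := by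
      have hwi : Integrable fun x => w x t :=
        (continuous_slice hwreg.continuousOn ht).integrable_of_hasCompactSupport
          (hasCompactSupport_of_norm_gt fun x hx => hwsupp x t ht hx)
      exact (hwi.sub hpi).congr (ae_of_all _ fun x => by simp [hwt x])
    rw [integral_congr_ae (ae_of_all _ hwt), integral_add hlapi hpi,
      integral_lap_eq_zero hslice hcs, zero_add]
    exact rpow_abs_integral_le hp (add_pos ht0 hR) hslice.continuous fun x hx => husupp x t ht hx
  intro t ht
  rw [hF2 t ht]
  have hclos : t ∈ closure (S ∩ Ioi 0) := by
    rw [mem_closure_iff_nhdsWithin_neBot]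
    have hle : 𝓝[>] t ≤ 𝓝[S ∩ Ioi 0] t := by
      refine le_inf inf_le_left (le_principal_iff.2 ?_)
      filter_upwards [mem_nhdsWithin_of_mem_nhds (mem_timeSet_Iio ht), self_mem_nhdsWithin]
        with s hs hs0
      have h := ht.1.trans_lt (mem_Ioi.1 hs0)
      exact ⟨⟨h.le, hs⟩, h⟩
    exact NeBot.mono inferInstance hle
  have hFc := continuousOn_integral_of_supp (μ := volume) hreg.continuousOn husupp t ht
  have hwc := continuousOn_integral_of_supp (μ := volume) hwreg.continuousOn hwsupp t ht
  refine ContinuousWithinAt.closure_le (s := S ∩ Ioi 0) hclos (ContinuousWithinAt.mono ?_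
    inter_subset_left) (hwc.mono inter_subset_left) hpos
  refine ContinuousWithinAt.mul (continuousWithinAt_const.mul ?_)
    (hFc.abs.rpow_const (Or.inr (by linarith)))
  exact (continuousWithinAt_id.add continuousWithinAt_const).rpow_const
    (Or.inl (add_pos_of_nonneg_of_pos ht.1 hR).ne')
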